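/- arXiv:0912.2513 — 2 statements merged into one kernel-verified Lean document; each statement's English description precedes it below -/
import Mathlib

section
/- If κ + λ < p and the pair (p, q) is of Type II, then the Frobenius number g of {d0, d1, d2, d3} equals g1 if and only if κ + λ ≤ p - λ. -/
/-- `n` is representable as a nonnegative integer combination of `d0, d1, d2, d3`. -/
def Representable (d0 d1 d2 d3 n : ℤ) : Prop :=
  ∃ x y z w : ℤ, 0 ≤ x ∧ 0 ≤ y ∧ 0 ≤ z ∧ 0 ≤ w ∧
    n = x * d0 + y * d1 + z * d2 + w * d3

/-- `g` is the Frobenius number of `{d0, d1, d2, d3}`: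
it is not representable, and every larger integer is representable. -/
def IsFrob (d0 d1 d2 d3 g : ℤ) : Prop :=
  ¬ Representable d0 d1 d2 d3 g ∧ ∀ n : ℤ, g < n → Representable d0 d1 d2 d3 n

/-- Lower bound for the number of coins of values `q`, `p`, `1` needed to pay the amount
`Y * q + α * p + β`, where `α * p + β` is the greedy remainder modulo `q`. -/
lemma coin_count_lower_bound
    {p q p' κ lam lam' τ i Y α β y z w : ℤ}
    (hp' : p = 2 * p' + 1) (hdiv : q = κ * p + lam) (hq : 0 < q)
    (hlam1 : 1 ≤ lam) (hlam2 : lam < p) (hkl : κ + lam = 2 * lam' + 1) (hlt : lam' < p')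
    (hτ : p ≤ (τ + 2) * (p - lam))
    (hTypeII : (τ + 1) * p' ≤ (τ + 2) * lam')
    (hβi : β < (i + 1) * (p - lam)) (hβp : β < p)
    (hαβ : α * p + β < q) (hz : 0 ≤ z) (hw : 0 ≤ w)
    (hS : y * q + z * p + w = Y * q + α * p + β) :
    Y + α + β - (p - lam - κ) * i ≤ y + z + w := by
  have hp0 : 0 < p := by omega
  obtain ⟨J, rfl⟩ : ∃ J, y = Y - J := ⟨Y - y, by ring⟩
  have hzw : z * p + w = α * p + β + J * q := by linarith
  have hJ : 0 ≤ J := by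
    by_contra! h
    have h1 : J * q ≤ -1 * q := mul_le_mul_of_nonneg_right (by omega) hq.le
    have h2 : 0 ≤ z * p := mul_nonneg hz hp0.le
    linarith
  obtain ⟨h, rfl⟩ : ∃ h, z = α + J * κ + (J - h) := ⟨α + J * κ + J - z, by ring⟩
  have hw' : w = β + h * p - J * (p - lam) := by
    rw [hdiv] at hzw
    linear_combination hzw
  have hβJ : J * (p - lam) - β ≤ h * p := by linarith
  have hh0 : 0 ≤ h := by
    by_contra! hneg
    have h1 : h * p ≤ -1 * p := mul_le_mul_of_nonneg_right (by omega) hp0.le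
    have h2 : 0 ≤ J * (p - lam) := mul_nonneg hJ (by omega)
    linarith
  have hstep : J - i ≤ h * (τ + 2) := by
    by_contra! hlt'
    have h1 : h * (τ + 2) * (p - lam) ≤ (J - i - 1) * (p - lam) :=
      mul_le_mul_of_nonneg_right (by omega) (by omega)
    have h2 : h * p ≤ h * ((τ + 2) * (p - lam)) := mul_le_mul_of_nonneg_left hτ hh0
    linarith
  have h1 : (J - i) * (p' - lam') ≤ h * (τ + 2) * (p' - lam') :=
    mul_le_mul_of_nonneg_right hstep (by omega)
  have h2 : h * ((τ + 2) * (p' - lam')) ≤ h * p' :=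
    mul_le_mul_of_nonneg_left (by linarith) hh0
  have h3 : (J - i) * (p' - lam') ≤ h * p' := by linarith
  have hκ : κ = 2 * lam' + 1 - lam := by omega
  subst hκ hp'
  rw [hw']
  linarith

/-- If `2 * n` is `(c - 2) * (p * q)` minus an amount needing at least `c` coins of values
`q`, `p`, `1`, then `n` is not representable. -/
lemma not_representable_of_coin_count
    {p q p' q' κ lam lam' τ d0 d1 d2 d3 i β n : ℤ}
    (hp' : p = 2 * p' + 1) (hq' : q = 2 * q' + 1)
    (hdiv : q = κ * p + lam) (hq : 0 < q)
    (hlam1 : 1 ≤ lam) (hlam2 : lam < p) (hkl : κ + lam = 2 * lam' + 1) (hlt : lam' < p')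
    (hτ : p ≤ (τ + 2) * (p - lam))
    (hTypeII : (τ + 1) * p' ≤ (τ + 2) * lam')
    (hd0 : d0 = p * q) (hd1 : d1 = p' * q) (hd2 : d2 = p * q')
    (hd3 : 2 * d3 = p * q - 1)
    (hβi : β < (i + 1) * (p - lam)) (hβp : β < p)
    (hn : 2 * n = (p + κ + β - 4 - (p - lam - κ) * i) * (p * q)
      - ((p - 1) * q + (κ - 1) * p + β)) :
    ¬ Representable d0 d1 d2 d3 n := by
  rintro ⟨x, y, z, w, hx, hy, hz, hw, rfl⟩
  obtain ⟨c, hc⟩ : ∃ c, c = p + κ + β - 2 - (p - lam - κ) * i := ⟨_, rfl⟩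
  obtain ⟨j, hj⟩ : ∃ j, j = 2 * x + y + z + w - c + 2 := ⟨_, rfl⟩
  have hαβ : (κ - 1) * p + β < q := by linarith
  have hS : y * q + z * p + w = (p - 1 + j * p) * q + (κ - 1) * p + β := by
    subst hd0 hd1 hd2 hj hc
    rw [hp'] at *
    rw [hq'] at *
    linear_combination (-1 : ℤ) * hn + w * hd3
  have hbound := coin_count_lower_bound hp' hdiv hq hlam1 hlam2 hkl hlt hτ hTypeII
    hβi hβp hαβ hz hw hS
  have hjneg : j < 0 := by
    by_contra! hj0
    have : j * 1 ≤ j * p := mul_le_mul_of_nonneg_left (by omega) hj0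
    linarith
  have h1 : (p - 1 + j * p) * q ≤ -1 * q := by
    refine mul_le_mul_of_nonneg_right ?_ hq.le
    have : j * p ≤ -1 * p := mul_le_mul_of_nonneg_right (by omega) (by omega)
    linarith
  have h2 : 0 ≤ y * q := mul_nonneg hy hq.le
  have h3 : 0 ≤ z * p := mul_nonneg hz (by omega)
  linarith

/-- If `2 * n` is `k * (p * q)` minus an amount payable with fewer than `k + 2` coins of values
`q`, `p`, `1`, then `n` is representable. -/
lemma representable_of_coin_count
    {p q p' q' d0 d1 d2 d3 k y z w n : ℤ}
    (hp' : p = 2 * p' + 1) (hq' : q = 2 * q' + 1)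
    (hd0 : d0 = p * q) (hd1 : d1 = p' * q) (hd2 : d2 = p * q')
    (hd3 : 2 * d3 = p * q - 1)
    (hy : 0 ≤ y) (hz : 0 ≤ z) (hw : 0 ≤ w)
    (hn : 2 * n = k * (p * q) - (y * q + z * p + w)) (hk : y + z + w < k + 2) :
    Representable d0 d1 d2 d3 n := by
  have hpar : ∃ x, k - (y + z + w) = 2 * x := by
    refine ⟨n - k * (2 * p' * q' + p' + q') + y * q' + z * p', ?_⟩
    rw [hp', hq'] at hn
    linear_combination (-1 : ℤ) * hn
  obtain ⟨x, hx⟩ := hpar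
  refine ⟨x, y, z, w, by omega, hy, hz, hw, ?_⟩
  have hk' : k = 2 * x + y + z + w := by linarith
  have : 2 * n = 2 * (x * d0 + y * d1 + z * d2 + w * d3) := by
    rw [hn, hk', hd0, hd1, hd2]
    rw [hp', hq'] at *
    linear_combination (-w) * hd3
  linarith

lemma IsFrob.unique {d0 d1 d2 d3 g h : ℤ} (hg : IsFrob d0 d1 d2 d3 g)
    (hh : IsFrob d0 d1 d2 d3 h) : g = h := by
  rcases lt_trichotomy g h with hlt | heq | hlt
  · exact absurd (hg.2 h hlt) hh.1
  · exact heq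
  · exact absurd (hh.2 g hlt) hg.1

/-- If `κ + lam ≤ p - lam`, every integer above the candidate value is representable. -/
lemma representable_of_gt
    {p q p' q' κ lam d0 d1 d2 d3 n : ℤ}
    (hp1 : 0 < p') (hp' : p = 2 * p' + 1) (hq' : q = 2 * q' + 1)
    (hκ : 1 ≤ κ) (hdiv : q = κ * p + lam) (hq : 0 < q)
    (hlam1 : 1 ≤ lam)
    (hd0 : d0 = p * q) (hd1 : d1 = p' * q) (hd2 : d2 = p * q')
    (hd3 : 2 * d3 = p * q - 1) (hle : κ + lam ≤ p - lam)
    (hn : (2 * p + κ - 5 - lam) * (p * q) - ((p - 1) * q + κ * p - 1 - lam) < 2 * n) :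
    Representable d0 d1 d2 d3 n := by
  have hp0 : 0 < p := by omega
  have hN : 0 < p * q := mul_pos hp0 hq
  obtain ⟨s, hs⟩ : ∃ s, s = (-(2 * n)) % (p * q) := ⟨_, rfl⟩
  obtain ⟨k, hk⟩ : ∃ k, k = -((-(2 * n)) / (p * q)) := ⟨_, rfl⟩
  have hs0 : 0 ≤ s := hs ▸ Int.emod_nonneg _ hN.ne'
  have hsN : s < p * q := hs ▸ Int.emod_lt_of_pos _ hN
  have hnk : 2 * n = k * (p * q) - s := by
    have := Int.mul_ediv_add_emod (-(2 * n)) (p * q)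
    rw [hs, hk]
    linarith
  obtain ⟨Y, hY⟩ : ∃ Y, Y = s / q := ⟨_, rfl⟩
  obtain ⟨t, ht⟩ : ∃ t, t = s % q := ⟨_, rfl⟩
  have ht0 : 0 ≤ t := ht ▸ Int.emod_nonneg _ hq.ne'
  have htq : t < q := ht ▸ Int.emod_lt_of_pos _ hq
  have hst : s = Y * q + t := by
    have := Int.mul_ediv_add_emod s q
    rw [hY, ht]
    linarith
  have hY0 : 0 ≤ Y := hY ▸ Int.ediv_nonneg hs0 hq.le
  have hYp : Y < p := hY ▸ Int.ediv_lt_of_lt_mul hq hsN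
  obtain ⟨α, hα⟩ : ∃ α, α = t / p := ⟨_, rfl⟩
  obtain ⟨β, hβ⟩ : ∃ β, β = t % p := ⟨_, rfl⟩
  have hβ0 : 0 ≤ β := hβ ▸ Int.emod_nonneg _ hp0.ne'
  have hβp : β < p := hβ ▸ Int.emod_lt_of_pos _ hp0
  have hα0 : 0 ≤ α := hα ▸ Int.ediv_nonneg ht0 hp0.le
  have htα : t = α * p + β := by
    have := Int.mul_ediv_add_emod t p
    rw [hα, hβ]
    linarith
  clear hs hk hY ht hα hβ
  have hακ : α ≤ κ - 1 ∨ α = κ ∧ β < lam := by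
    rcases lt_trichotomy α κ with h | h | h
    · left; omega
    · right
      subst h
      exact ⟨rfl, by linarith⟩
    · have : (κ + 1) * p ≤ α * p := mul_le_mul_of_nonneg_right (by omega) hp0.le
      linarith
  have key : ∀ c, (c ≤ 2 * p + κ - 3 - lam) →
      (c = 2 * p + κ - 3 - lam → (p - 1) * q + κ * p - 1 - lam ≤ s) → c < k + 2 := by
    intro c hc1 hc2
    by_contra! hck
    have h1 : k * (p * q) ≤ (c - 2) * (p * q) :=
      mul_le_mul_of_nonneg_right (by omega) hN.le
    rcases hc1.lt_or_eq with hlt | heq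
    · have h2 : c * (p * q) ≤ (2 * p + κ - 3 - lam - 1) * (p * q) :=
        mul_le_mul_of_nonneg_right (by omega) hN.le
      linarith
    · have := hc2 heq
      rw [heq] at h1
      linarith
  have hsize : Y = p - 1 → (α = κ - 1 ∧ p - lam - 1 ≤ β ∨ α = κ) →
      (p - 1) * q + κ * p - 1 - lam ≤ s := by
    rintro rfl (⟨rfl, h⟩ | rfl) <;> linarith
  by_cases hcase : 1 ≤ Y ∧ p - lam ≤ β
  · obtain ⟨hY1, hβD⟩ := hcase
    refine representable_of_coin_count (k := k) (y := Y - 1) (z := α + κ + 1) (w := β - (p - lam))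
      hp' hq' hd0 hd1 hd2 hd3 (by omega) (by omega) (by omega) ?_ ?_
    · rw [hnk, hst, htα, hdiv]; ring
    · exact key _ (by omega) (fun h => hsize (by omega) (by omega))
  · refine representable_of_coin_count (k := k) (y := Y) (z := α) (w := β)
      hp' hq' hd0 hd1 hd2 hd3 hY0 hα0 hβ0 ?_ ?_
    · rw [hnk, hst, htα]; ring
    · exact key _ (by omega) (fun h => hsize (by omega) (by omega))

theorem frobenius_typeII_eq_g1_iff
    (p q p' q' κ lam κ' lam' τ d0 d1 d2 d3 g0 g1 g : ℤ)
    (hp : Prime p) (hq : Prime q) (h2p : 2 < p) (hpq : p < q)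
    (hp' : p = 2 * p' + 1) (hq' : q = 2 * q' + 1)
    (hdiv : q = κ * p + lam) (hlam1 : 1 ≤ lam) (hlam2 : lam ≤ p - 1)
    (hdiv' : q' = κ' * p' + lam') (hlam'1 : 0 ≤ lam') (hlam'2 : lam' ≤ p' - 1)
    (hd0 : d0 = p * q) (hd1 : d1 = p' * q) (hd2 : d2 = p * q')
    (hd3 : 2 * d3 = p * q - 1)
    (hg0 : g0 = (p' - 1) * d0 + (p - 1) * d1 + κ * d2 - d3)
    (hg1 : g1 = g0 - lam * d3)
    (hfrob : IsFrob d0 d1 d2 d3 g)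
    (hkl : κ + lam < p)
    (hτ : τ = lam / (p - lam))
    (hTypeII : (τ + 1) * p' ≤ (τ + 2) * lam') :
    g = g1 ↔ κ + lam ≤ p - lam := by
  have hp1 : 0 < p' := by omega
  have hp0 : 0 < p := by omega
  have hq0 : 0 < q := by omega
  have hκ : 1 ≤ κ := by
    by_contra! h
    have : κ * p ≤ 0 := mul_nonpos_of_nonpos_of_nonneg (by omega) hp0.le
    omega
  have hκκ : κ = κ' := by
    have h : (κ - κ') * (2 * p') = 2 * lam' + 1 - κ - lam := by
      rw [hp', hq', hdiv'] at hdiv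
      linear_combination -hdiv
    rcases lt_trichotomy κ κ' with hlt | heq | hlt
    · have : (κ - κ') * (2 * p') ≤ -1 * (2 * p') :=
        mul_le_mul_of_nonneg_right (by omega) (by omega)
      omega
    · exact heq
    · have : 1 * (2 * p') ≤ (κ - κ') * (2 * p') :=
        mul_le_mul_of_nonneg_right (by omega) (by omega)
      omega
  have hkl' : κ + lam = 2 * lam' + 1 := by
    subst hκκ
    rw [hp', hq', hdiv'] at hdiv
    linarith
  have hD : 0 < p - lam := by omega
  have hτp : p ≤ (τ + 2) * (p - lam) := by
    have := Int.lt_ediv_add_one_mul_self lam hD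
    rw [← hτ] at this
    linarith
  have hnot := fun {i β n : ℤ} => not_representable_of_coin_count (i := i) (β := β) (n := n)
    hp' hq' hdiv hq0 hlam1 (by omega) hkl' (by omega) hτp hTypeII hd0 hd1 hd2 hd3
  have hg1' : 2 * g1 = (2 * p + κ - 5 - lam) * (p * q) - ((p - 1) * q + κ * p - 1 - lam) := by
    rw [hg1, hg0, hd0, hd1, hd2]
    rw [hp', hq'] at *
    linear_combination (-1 - lam) * hd3
  constructor
  · rintro rfl
    by_contra! hgt
    have hwit : ∀ β, p - lam - 1 < β - (p - lam - κ) → β < 2 * (p - lam) → β < p → False := by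
      intro β h1 h2 h3
      obtain ⟨n, hn⟩ : ∃ n, 2 * n = (p + κ + β - 4 - (p - lam - κ) * 1) * (p * q)
          - ((p - 1) * q + (κ - 1) * p + β) := by
        have hd : 2 ∣ (p + κ + β - 4 - (p - lam - κ) * 1) * (p * q)
            - ((p - 1) * q + (κ - 1) * p + β) := by
          have hlam : lam = 2 * lam' + 1 - κ := by omega
          refine ⟨(p + κ + β - 4 - (p - lam - κ) * 1) * (2 * p' * q' + p' + q')
            + lam' - 1 - p' * q - (κ - 1) * p', ?_⟩
          rw [hlam, hp', hq']
          ring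
        obtain ⟨n, hn⟩ := hd
        exact ⟨n, hn.symm⟩
      refine hnot (i := 1) (β := β) (by omega) h3 hn (hfrob.2 n ?_)
      have hN : 0 < p * q := mul_pos hp0 hq0
      have h4 : (2 * p + κ - 4 - lam) * (p * q)
          ≤ (p + κ + β - 4 - (p - lam - κ) * 1) * (p * q) :=
        mul_le_mul_of_nonneg_right (by omega) hN.le
      have h5 : 1 * q ≤ p * q := mul_le_mul_of_nonneg_right (by omega) hq0.le
      linarith
    rcases le_or_gt (p - lam) lam with h | h
    · exact hwit (2 * (p - lam) - 1) (by omega) (by omega) (by omega)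
    · exact hwit (p - 1) (by omega) (by omega) (by omega)
  · intro hle
    refine hfrob.unique ⟨?_, fun n hn => ?_⟩
    · refine hnot (i := 0) (β := p - lam - 1) (by omega) (by omega) ?_
      rw [hg1']
      ring
    · exact representable_of_gt hp1 hp' hq' hκ hdiv hq0 hlam1 hd0 hd1 hd2 hd3 hle (by omega)
end

section
/- If κ + λ < p, the pair (p, q) is of Type I, and κ + λ ≤ p - λ, then the Frobenius number g of {d0, d1, d2, d3} satisfies g2 ≤ g < g1. -/
/-- Since `2 * d1 = p * q - q`, `2 * d2 = p * q - p` and `2 * d3 = p * q - 1`, an integer `n` with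
`2 * n = p * q * T - s` is representable as soon as `s` is a sum of at most `T` coins of
values `q`, `p` and `1`. -/
lemma representable_of_coins {p q p' q' d3 n T y z w : ℤ}
    (hp' : p = 2 * p' + 1) (hq' : q = 2 * q' + 1) (hd3 : 2 * d3 = p * q - 1)
    (hn : 2 * n = p * q * T - (y * q + z * p + w))
    (hy : 0 ≤ y) (hz : 0 ≤ z) (hw : 0 ≤ w) (hT : y + z + w ≤ T) :
    Representable (p * q) (p' * q) (p * q') d3 n := by
  have hx : 2 * (n - d3 * T + y * q' + z * p') = T - (y + z + w) := by
    linear_combination hn - T * hd3 - y * hq' - z * hp'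
  refine ⟨n - d3 * T + y * q' + z * p', y, z, w, by lia, hy, hz, hw, ?_⟩
  have h2 : 2 * n = 2 * ((n - d3 * T + y * q' + z * p') * (p * q) + y * (p' * q) +
      z * (p * q') + w * d3) := by
    linear_combination hn - (p * q) * hx - w * hd3 + (y * q) * hp' + (z * p) * hq'
  lia

/-- Conversely, if `n` is representable then `2 * n = p * q * T - s` for some sum `s` of at most
`T` coins of values `q`, `p` and `1`. -/
lemma exists_coins_of_representable {p q p' q' d3 n : ℤ}
    (hp' : p = 2 * p' + 1) (hq' : q = 2 * q' + 1) (hd3 : 2 * d3 = p * q - 1)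
    (h : Representable (p * q) (p' * q) (p * q') d3 n) :
    ∃ T y z w : ℤ, 0 ≤ y ∧ 0 ≤ z ∧ 0 ≤ w ∧ y + z + w ≤ T ∧
      2 * n = p * q * T - (y * q + z * p + w) := by
  obtain ⟨x, y, z, w, hx, hy, hz, hw, rfl⟩ := h
  refine ⟨2 * x + y + z + w, y, z, w, hy, hz, hw, by lia, ?_⟩
  linear_combination w * hd3 - (y * q) * hp' - (z * p) * hq'

/-- The lower bound: the integer called `g2` in the main theorem is not representable. -/
lemma not_representable_of_coins {p q p' q' d3 κ lam n : ℤ}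
    (hp' : p = 2 * p' + 1) (hq' : q = 2 * q' + 1) (hd3 : 2 * d3 = p * q - 1)
    (hdiv : q = κ * p + lam) (hκ : 1 ≤ κ) (hlam : 1 ≤ lam) (hsum : κ + lam ≤ p')
    (hn : 2 * n = p * q * (p + κ - 2) - ((p - 1) * q + (κ - 1) * p + 2)) :
    ¬ Representable (p * q) (p' * q) (p * q') d3 n := by
  intro h
  obtain ⟨T, y, z, w, hy, hz, hw, hT, hn'⟩ := exists_coins_of_representable hp' hq' hd3 h
  have hp : 0 < p := by lia
  have hqp : p < q := by nlinarith
  have hpq : 0 < p * q := mul_pos hp (hp.trans hqp)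
  have hs : y * q + z * p + w =
      p * q * (T - (p + κ - 2)) + ((p - 1) * q + (κ - 1) * p + 2) := by
    linear_combination hn' - hn
  obtain ⟨k, rfl⟩ : ∃ k, T = p + κ - 2 + k := ⟨T - (p + κ - 2), by ring⟩
  rw [add_sub_cancel_left] at hs
  have hcoin : y * q + z * p + w ≤ (p + κ - 2 + k) * q := by
    nlinarith [mul_le_mul_of_nonneg_left hqp.le hz, mul_le_mul_of_nonneg_right hT (hp.trans hqp).le,
      mul_le_mul_of_nonneg_left (show 1 ≤ q by lia) hw]
  have hk0 : 0 ≤ k := by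
    by_contra! hk
    have : y * q + z * p + w < 0 := by
      rw [hs]
      nlinarith [mul_le_mul_of_nonneg_left (show k ≤ -1 by lia) hpq.le]
    have := mul_nonneg hy (hp.trans hqp).le
    have := mul_nonneg hz hp.le
    lia
  have hk1 : k ≤ 0 := by
    by_contra! hk
    have h1 : q * (p * k + (p - 1)) < q * (p + κ - 2 + k) := by
      nlinarith [mul_nonneg (show 0 ≤ κ - 1 by lia) hp.le]
    have h2 := lt_of_mul_lt_mul_left h1 (hp.trans hqp).le
    nlinarith
  obtain rfl : k = 0 := le_antisymm hk1 hk0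
  have hyp : y ≤ p - 1 := by
    have h1 : q * y < q * p := by
      nlinarith [mul_nonneg hz hp.le]
    have h2 := lt_of_mul_lt_mul_left h1 (hp.trans hqp).le
    lia
  obtain ⟨j, rfl⟩ : ∃ j, y = p - 1 - j := ⟨p - 1 - y, by ring⟩
  have hj : 0 ≤ j := by lia
  have hzw : z * p + w = (j * κ + κ - 1) * p + j * lam + 2 := by
    linear_combination hs + j * hdiv
  have h3 : z * p + w ≤ (κ - 1 + j) * p := by
    nlinarith [mul_le_mul_of_nonneg_left (show 1 ≤ p by lia) hw]
  nlinarith [mul_nonneg (mul_nonneg hj (show 0 ≤ κ - 1 by lia)) hp.le,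
    mul_nonneg hj (show 0 ≤ lam by lia)]

/-- The upper bound: trading `q` for `κ` coins `p` and `lam` coins `1`, at most twice, in the greedy
change of `s` yields few enough coins. -/
lemma representable_of_large {p q p' q' d3 κ lam n T s : ℤ}
    (hp' : p = 2 * p' + 1) (hq' : q = 2 * q' + 1) (hd3 : 2 * d3 = p * q - 1)
    (hdiv : q = κ * p + lam) (hκ : 1 ≤ κ) (hlam : 1 ≤ lam) (hsum : κ + lam ≤ p')
    (hn : 2 * n = p * q * T - s) (hs0 : 0 ≤ s) (hs : s < p * q)
    (hT : 2 * p + κ - 5 - lam ≤ T) :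
    Representable (p * q) (p' * q) (p * q') d3 n := by
  have hp : 0 < p := by lia
  have hq : 0 < q := by nlinarith
  obtain ⟨a, r, hsar, ha, hr0, hr⟩ : ∃ a r, s = a * q + r ∧ 0 ≤ a ∧ 0 ≤ r ∧ r < q :=
    ⟨s / q, s % q, by linear_combination -(Int.mul_ediv_add_emod s q),
      Int.ediv_nonneg hs0 hq.le, Int.emod_nonneg _ hq.ne', Int.emod_lt_of_pos _ hq⟩
  obtain ⟨b, c, hrbc, hb, hc0, hc⟩ : ∃ b c, r = b * p + c ∧ 0 ≤ b ∧ 0 ≤ c ∧ c < p :=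
    ⟨r / p, r % p, by linear_combination -(Int.mul_ediv_add_emod r p),
      Int.ediv_nonneg hr0 hp.le, Int.emod_nonneg _ hp.ne', Int.emod_lt_of_pos _ hp⟩
  subst hrbc hsar
  have hap : a < p := by
    by_contra! h
    nlinarith [mul_le_mul_of_nonneg_right h hq.le]
  have hbκ : b ≤ κ := by
    by_contra! h
    nlinarith [mul_le_mul_of_nonneg_right (show κ + 1 ≤ b by lia) hp.le]
  rcases hbκ.eq_or_lt with rfl | hbκ
  · have hcl : c < lam := by lia
    exact representable_of_coins (T := T) (y := a) (z := b) (w := c) hp' hq' hd3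
      (by linear_combination hn) ha hb hc0 (by lia)
  by_cases hcount : a + b + c ≤ T
  · exact representable_of_coins (T := T) (y := a) (z := b) (w := c) hp' hq' hd3
      (by linear_combination hn) ha hb hc0 hcount
  by_cases hcl : p - lam ≤ c
  · exact representable_of_coins (T := T) (y := a - 1) (z := b + κ + 1) (w := c + lam - p)
      hp' hq' hd3 (by linear_combination hn - hdiv) (by lia) (by lia) (by lia) (by lia)
  have hpar : 2 * (n - d3 * T + a * q' + b * p') = T - (a + b + c) := by
    linear_combination hn - T * hd3 - a * hq' - b * hp'
  exact representable_of_coins (T := T) (y := a - 2) (z := b + 2 * κ + 1) (w := c + 2 * lam - p)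
    hp' hq' hd3 (by linear_combination hn - 2 * hdiv) (by lia) (by lia) (by lia) (by lia)

/-- Under the quotient bound `κ + lam < p`, Type I with `κ + lam ≤ p - lam` means
`κ + lam ≤ p'`. -/
lemma sum_le_half_of_typeI {p q p' q' κ lam κ' lam' τ : ℤ}
    (hp' : p = 2 * p' + 1) (hq' : q = 2 * q' + 1)
    (hdiv : q = κ * p + lam) (hκ : 1 ≤ κ) (hlam1 : 1 ≤ lam)
    (hdiv' : q' = κ' * p' + lam') (hlam'1 : 0 ≤ lam') (hlam'2 : lam' ≤ p' - 1)
    (hkl : κ + lam < p) (hτ : τ = lam / (p - lam))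
    (hTypeI : (τ + 2) * lam' < (τ + 1) * p') (hkl2 : κ + lam ≤ p - lam) :
    κ + lam ≤ p' := by
  have hτ0 : τ = 0 := hτ.trans (Int.ediv_eq_zero_of_lt (by lia) (by lia))
  subst hτ0
  have hm : 2 * (q' - κ * p') + 1 = κ + lam := by
    linear_combination hdiv + κ * hp' - hq'
  have hκκ' : (κ - κ') * p' = lam' - (q' - κ * p') := by linear_combination hdiv'
  have hzero : κ - κ' = 0 := by
    refine le_antisymm ?_ ?_ <;> by_contra! h <;> nlinarith
  rw [hzero] at hκκ'
  lia

theorem frobenius_typeI_bounds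
    (p q p' q' κ lam κ' lam' τ d0 d1 d2 d3 g0 g1 g2 g : ℤ)
    (hp : Prime p) (hq : Prime q) (h2p : 2 < p) (hpq : p < q)
    (hp' : p = 2 * p' + 1) (hq' : q = 2 * q' + 1)
    (hdiv : q = κ * p + lam) (hlam1 : 1 ≤ lam) (hlam2 : lam ≤ p - 1)
    (hdiv' : q' = κ' * p' + lam') (hlam'1 : 0 ≤ lam') (hlam'2 : lam' ≤ p' - 1)
    (hd0 : d0 = p * q) (hd1 : d1 = p' * q) (hd2 : d2 = p * q')
    (hd3 : 2 * d3 = p * q - 1)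
    (hg0 : g0 = (p' - 1) * d0 + (p - 1) * d1 + κ * d2 - d3)
    (hg1 : g1 = g0 - lam * d3)
    (hg2 : g2 = g0 - (p - 3) * d3)
    (hfrob : IsFrob d0 d1 d2 d3 g)
    (hkl : κ + lam < p)
    (hτ : τ = lam / (p - lam))
    (hTypeI : (τ + 2) * lam' < (τ + 1) * p')
    (hkl2 : κ + lam ≤ p - lam) :
    g2 ≤ g ∧ g < g1 := by
  have hp0 : 0 < p := by lia
  have hκ : 1 ≤ κ := by
    by_contra! h
    nlinarith
  have hsum := sum_le_half_of_typeI hp' hq' hdiv hκ hlam1 hdiv' hlam'1 hlam'2 hkl hτ hTypeI hkl2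
  have hpq0 : 0 < p * q := mul_pos hp0 (hp0.trans hpq)
  obtain ⟨hg, hlarge⟩ := hfrob
  subst hd0 hd1 hd2
  have h2g0 : 2 * g0 = p * q * (2 * p + κ - 6) + lam + 1 := by
    linear_combination 2 * hg0 - hd3 - (p * q + q * (p - 1)) * hp' - κ * p * hq' + hdiv
  constructor
  · by_contra! h
    refine not_representable_of_coins hp' hq' hd3 hdiv hκ hlam1 hsum ?_ (hlarge g2 h)
    linear_combination 2 * hg2 + h2g0 - (p - 3) * hd3 - hdiv
  · by_contra! h
    have hdm := Int.mul_ediv_add_emod (-(2 * g)) (p * q)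
    have hs0 := Int.emod_nonneg (-(2 * g)) hpq0.ne'
    refine hg (representable_of_large (T := -(-(2 * g) / (p * q))) (s := -(2 * g) % (p * q))
      hp' hq' hd3 hdiv hκ hlam1 hsum (by linear_combination hdm) hs0
      (Int.emod_lt_of_pos _ hpq0) ?_)
    have h2g1 : 2 * g1 = p * q * (2 * p + κ - 6 - lam) + (2 * lam + 1) := by
      linear_combination 2 * hg1 + h2g0 - lam * hd3
    have hlt : p * q * (2 * p + κ - 6 - lam) < p * q * -(-(2 * g) / (p * q)) := by
      rw [mul_neg]
      lia
    have := lt_of_mul_lt_mul_left hlt hpq0.le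
    lia
end
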